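/- arXiv:1808.05013 — 2 statements merged into one kernel-verified Lean document; each statement's English description precedes it below -/
import Mathlib

section
/- Let κ, μ, m_t, r̂ > 0, m_s > 1 and r > 0. Set K = μ(1+κ), θ₁ = (1+m_s+μ)/2 and let s₂(·) be the single shadowed κ-μ Type II (inverse Nakagami-m) PDF, s₂(y) = 2(m_s−1)^{m_s}(1+κ)^μ μ^μ y^{2μ−1} r̂^{2m_s}/(B(m_s,μ)[y²(1+κ)μ + r̂²(m_s−1+κμ)]^{m_s+μ}) · ₂F₁((m_s+μ)/2, θ₁; μ; 4μ²κ(1+κ)y²r̂²/[y²(1+κ)μ + r̂²(m_s−1+κμ)]²). Then ∫₀^∞ (1/a) s₂(r/a) · (2 m_t^{m_t} a^{2m_t−1} e^{−m_t a²}/Γ(m_t)) da = (2(m_s−1)^{m_s}(m_t K)^μ r^{2μ−1} / (Γ(m_t) B(m_s,μ) r̂^{2μ} (m_s−1+κμ)^{μ+m_s})) · ∑_{i=0}^∞ (((m_s+μ)/2)_i (θ₁)_i Γ(i+m_s+m_t) / (i! (μ)_i r̂^{2i})) · ((4r²κμK m_t)^i / (m_s−1+κμ)^{2i}) · U(2i+μ+m_s,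 1+i+μ−m_t, r²K m_t/(r̂²(m_s−1+κμ))). -/
open MeasureTheory Set

/-- Pochhammer (rising factorial) symbol `(a)_n = Γ(a+n)/Γ(a)`. -/
noncomputable def poch (a : ℝ) (n : ℕ) : ℝ := Real.Gamma (a + n) / Real.Gamma a

/-- Beta function `B(x,y) = Γ(x)Γ(y)/Γ(x+y)`. -/
noncomputable def betaFn (x y : ℝ) : ℝ := Real.Gamma x * Real.Gamma y / Real.Gamma (x + y)

/-- Modified Bessel function of the first kind of real order ν. -/
noncomputable def besselI (ν x : ℝ) : ℝ :=
  ∑' k : ℕ, (x / 2) ^ (ν + 2 * (k : ℝ)) / ((k.factorial : ℝ) * Real.Gamma (ν + (k : ℝ) + 1))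

/-- Modified Bessel function of the second kind of real order ν. -/
noncomputable def besselK (ν x : ℝ) : ℝ :=
  ∫ t in Ioi (0 : ℝ), Real.exp (-x * Real.cosh t) * Real.cosh (ν * t)

/-- Confluent hypergeometric function ₁F₁(a;b;z). -/
noncomputable def hyp1F1 (a b z : ℝ) : ℝ :=
  ∑' n : ℕ, poch a n * z ^ n / (poch b n * (n.factorial : ℝ))

/-- Gauss hypergeometric function ₂F₁(a,b;c;z). -/
noncomputable def hyp2F1 (a b c z : ℝ) : ℝ :=
  ∑' n : ℕ, poch a n * poch b n * z ^ n / (poch c n * (n.factorial : ℝ))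

/-- Tricomi confluent hypergeometric function U(a,b,z). -/
noncomputable def tricomiU (a b z : ℝ) : ℝ :=
  (1 / Real.Gamma a) *
    ∫ t in Ioi (0 : ℝ), Real.exp (-z * t) * t ^ (a - 1) * (1 + t) ^ (b - a - 1)

/-- Regularized generalized hypergeometric function ₃F̃₁(a₁,a₂,a₃;b;z). -/
noncomputable def hyp3F1reg (a₁ a₂ a₃ b z : ℝ) : ℝ :=
  ∑' n : ℕ, poch a₁ n * poch a₂ n * poch a₃ n * z ^ n /
    (Real.Gamma (b + n) * (n.factorial : ℝ))

/-- Regularized generalized hypergeometric function ₂F̃₂(a,b;c,d;z). -/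
noncomputable def hyp2F2reg (a b c d z : ℝ) : ℝ :=
  ∑' n : ℕ, poch a n * poch b n * z ^ n /
    (Real.Gamma (c + n) * Real.Gamma (d + n) * (n.factorial : ℝ))

lemma poch_pos {a : ℝ} (ha : 0 < a) (n : ℕ) : 0 < poch a n :=
  div_pos (Real.Gamma_pos_of_pos (by positivity)) (Real.Gamma_pos_of_pos ha)

lemma poch_succ {a : ℝ} (ha : 0 < a) (n : ℕ) : poch a (n + 1) = (a + n) * poch a n := by
  unfold poch
  push_cast
  rw [← add_assoc, Real.Gamma_add_one (by positivity), mul_div_assoc]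

lemma summable_hyp2F1 {a b c z : ℝ} (ha : 0 < a) (hb : 0 < b) (hc : 0 < c)
    (hz : 0 < z) (hz1 : z < 1) :
    Summable fun n : ℕ => poch a n * poch b n * z ^ n / (poch c n * (n.factorial : ℝ)) := by
  have pos (n : ℕ) : 0 < poch a n * poch b n * z ^ n / (poch c n * (n.factorial : ℝ)) := by
    have := poch_pos ha n
    have := poch_pos hb n
    have := poch_pos hc n
    positivity
  refine summable_of_ratio_test_tendsto_lt_one hz1
    (Filter.Eventually.of_forall fun n => (pos n).ne') ?_
  have lim (x y : ℝ) :
      Filter.Tendsto (fun n : ℕ => (x + n) / (y + n)) Filter.atTop (nhds 1) := by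
    have h := tendsto_add_mul_div_add_mul_atTop_nhds x y (1 : ℝ) (one_ne_zero (α := ℝ))
    simpa using h
  have h := ((lim a c).mul (lim b 1)).mul_const z
  simp only [one_mul] at h
  refine h.congr fun n => ?_
  rw [Real.norm_of_nonneg (pos _).le, Real.norm_of_nonneg (pos _).le,
    poch_succ ha, poch_succ hb, poch_succ hc, Nat.factorial_succ]
  have := poch_pos ha n
  have := poch_pos hb n
  have := poch_pos hc n
  push_cast
  field_simp
  ring

/-- Termwise integration of a pointwise convergent series of nonnegative integrable functions;
if the series of integrals diverges, both sides are zero by convention. -/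
lemma integral_tsum_of_nonneg_of_summable {α : Type*} [MeasurableSpace α] {ν : Measure α}
    {f : ℕ → α → ℝ} (hf : ∀ i, Integrable (f i) ν) (h0 : ∀ i, 0 ≤ᵐ[ν] f i)
    (hs : ∀ᵐ x ∂ν, Summable fun i => f i x) :
    ∫ x, ∑' i, f i x ∂ν = ∑' i, ∫ x, f i x ∂ν := by
  have h0' := ae_all_iff.2 h0
  have hm : AEMeasurable (fun x => ∑' i, f i x) ν :=
    AEMeasurable.tsum fun i => (hf i).aemeasurable
  rw [integral_eq_lintegral_of_nonneg_ae (by filter_upwards [h0'] with x hx using tsum_nonneg hx)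
    hm.aestronglyMeasurable]
  have : ∫⁻ x, ENNReal.ofReal (∑' i, f i x) ∂ν = ∑' i, ENNReal.ofReal (∫ x, f i x ∂ν) := by
    rw [tsum_congr fun i => ofReal_integral_eq_lintegral_ofReal (hf i) (h0 i),
      ← lintegral_tsum fun i => (hf i).aemeasurable.ennreal_ofReal]
    refine lintegral_congr_ae ?_
    filter_upwards [h0', hs] with x hx hsx
    exact ENNReal.ofReal_tsum_of_nonneg hx hsx
  rw [this, ENNReal.tsum_toReal_eq fun i => ENNReal.ofReal_ne_top]
  exact tsum_congr fun i => ENNReal.toReal_ofReal (integral_nonneg_of_ae (h0 i))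

lemma integral_exp_mul_rpow_mul_exp {p q m s : ℝ} (hp : 0 < p) (hm : 0 < m + s * q) :
    ∫ u in Ioi (0 : ℝ), u ^ (p - 1) * Real.exp (-m * u) * Real.exp (-(s * q) * u) =
      Real.Gamma p * (m + s * q) ^ (-p) := by
  have h := Real.integral_rpow_mul_exp_neg_mul_Ioi hp hm
  rw [one_div, Real.inv_rpow hm.le, ← Real.rpow_neg hm.le, mul_comm (_ ^ _)] at h
  rw [← h]
  refine setIntegral_congr_fun measurableSet_Ioi fun u _ => ?_
  simp only [mul_assoc, ← Real.exp_add]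
  ring_nf

lemma integrableOn_rpow_mul_exp {p m : ℝ} (hp : 0 < p) (hm : 0 < m) :
    IntegrableOn (fun u : ℝ => u ^ (p - 1) * Real.exp (-m * u)) (Ioi 0) := by
  have h := integrableOn_rpow_mul_exp_neg_mul_rpow (p := 1) (s := p - 1) (b := m)
    (by linarith) one_pos hm
  simpa using h

/-- The symmetry behind Kummer's transformation of Tricomi's function. -/
lemma Gamma_mul_integral_swap {p c m α β : ℝ} (hp : 0 < p) (hc : 0 < c) (hm : 0 < m)
    (hα : 0 < α) (hβ : 0 < β) :
    Real.Gamma c *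
        ∫ u in Ioi (0 : ℝ), u ^ (p - 1) * Real.exp (-m * u) * (α + u * β) ^ (-c) =
      Real.Gamma p *
        ∫ s in Ioi (0 : ℝ), s ^ (c - 1) * Real.exp (-α * s) * (m + s * β) ^ (-p) := by
  let F : ℝ → ℝ → ℝ := fun u s =>
    (u ^ (p - 1) * Real.exp (-m * u)) * (s ^ (c - 1) * Real.exp (-α * s)) *
      Real.exp (-(s * β) * u)
  have hF : Integrable (Function.uncurry F)
      ((volume.restrict (Ioi 0)).prod (volume.restrict (Ioi 0))) := by
    have hd := Integrable.mul_prod (integrableOn_rpow_mul_exp hp hm)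
      (integrableOn_rpow_mul_exp hc hα)
    refine hd.mono (by unfold Function.uncurry; fun_prop) ?_
    rw [Measure.prod_restrict]
    filter_upwards [ae_restrict_mem (measurableSet_Ioi.prod measurableSet_Ioi)] with x hx
    obtain ⟨h1, h2⟩ := hx
    simp only [mem_Ioi] at h1 h2
    simp only [Function.uncurry, F]
    rw [norm_mul _ (Real.exp _)]
    refine mul_le_of_le_one_right (norm_nonneg _) ?_
    rw [Real.norm_of_nonneg (Real.exp_nonneg _), Real.exp_le_one_iff]
    have := mul_pos (mul_pos h2 hβ) h1
    linarith
  rw [← integral_const_mul, ← integral_const_mul]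
  calc _ = ∫ u in Ioi (0 : ℝ), ∫ s in Ioi (0 : ℝ), F u s := by
        refine setIntegral_congr_fun measurableSet_Ioi fun u hu => ?_
        have hu : 0 < u := hu
        rw [mul_left_comm, ← integral_exp_mul_rpow_mul_exp hc (by positivity),
          ← integral_const_mul]
        refine integral_congr_ae (Filter.Eventually.of_forall fun s => ?_)
        simp only [F]
        ring_nf
    _ = ∫ s in Ioi (0 : ℝ), ∫ u in Ioi (0 : ℝ), F u s := integral_integral_swap hF
    _ = _ := by
        refine setIntegral_congr_fun measurableSet_Ioi fun s hs => ?_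
        have hs : 0 < s := hs
        rw [mul_left_comm, ← integral_exp_mul_rpow_mul_exp hp (by positivity),
          ← integral_const_mul]
        refine integral_congr_ae (Filter.Eventually.of_forall fun u => ?_)
        simp only [F]
        ring_nf

lemma integral_eq_tricomiU {p c m α β : ℝ} (hp : 0 < p) (hc : 0 < c) (hm : 0 < m)
    (hα : 0 < α) (hβ : 0 < β) :
    ∫ u in Ioi (0 : ℝ), u ^ (p - 1) * Real.exp (-m * u) * (α + u * β) ^ (-c) =
      Real.Gamma p * m ^ (c - p) * β ^ (-c) * tricomiU c (c - p + 1) (α * m / β) := by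
  have hΓ := (Real.Gamma_pos_of_pos hc).ne'
  have hmβ : 0 < m / β := by positivity
  have hsub : ∫ s in Ioi (0 : ℝ), s ^ (c - 1) * Real.exp (-α * s) * (m + s * β) ^ (-p) =
      m ^ (c - p) * β ^ (-c) * ∫ t in Ioi (0 : ℝ),
        Real.exp (-(α * m / β) * t) * t ^ (c - 1) * (1 + t) ^ (c - p + 1 - c - 1) := by
    have h := integral_comp_mul_left_Ioi
      (fun s : ℝ => s ^ (c - 1) * Real.exp (-α * s) * (m + s * β) ^ (-p)) 0 hmβ
    rw [mul_zero, smul_eq_mul, inv_mul_eq_div, eq_div_iff hmβ.ne'] at h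
    rw [← h, ← integral_const_mul, ← integral_mul_const]
    refine setIntegral_congr_fun measurableSet_Ioi fun t ht => ?_
    have ht : 0 < t := ht
    rw [show m + m / β * t * β = m * (1 + t) by field_simp,
      Real.mul_rpow hm.le (by positivity), Real.mul_rpow hmβ.le ht.le,
      show c - p + 1 - c - 1 = -p by ring, show -α * (m / β * t) = -(α * m / β) * t by ring,
      Real.rpow_sub_one hmβ.ne', Real.div_rpow hm.le hβ.le, Real.rpow_neg hβ.le,
      sub_eq_add_neg c p, Real.rpow_add hm]
    field_simp
  rw [← mul_right_inj' hΓ, Gamma_mul_integral_swap hp hc hm hα hβ, hsub, tricomiU]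
  field_simp

lemma integral_sq_eq_tricomiU {p c m α β : ℝ} (hp : 0 < p) (hc : 0 < c) (hm : 0 < m)
    (hα : 0 < α) (hβ : 0 < β) :
    ∫ a in Ioi (0 : ℝ), a ^ (2 * p - 1) * Real.exp (-m * a ^ 2) * (α + a ^ 2 * β) ^ (-c) =
      Real.Gamma p * m ^ (c - p) * β ^ (-c) * tricomiU c (c - p + 1) (α * m / β) / 2 := by
  rw [← integral_eq_tricomiU hp hc hm hα hβ, ← integral_comp_rpow_Ioi_of_pos
    (g := fun u : ℝ => u ^ (p - 1) * Real.exp (-m * u) * (α + u * β) ^ (-c)) two_pos,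
    ← integral_div]
  refine setIntegral_congr_fun measurableSet_Ioi fun a ha => ?_
  have ha : 0 < a := ha
  simp only [smul_eq_mul]
  rw [show 2 * p - 1 = 1 + 2 * (p - 1) by ring, Real.rpow_add ha, Real.rpow_mul ha.le,
    Real.rpow_two, show (2 : ℝ) - 1 = 1 by norm_num]
  ring

lemma integrableOn_sq {p c m α β : ℝ} (hp : 0 < p) (hc : 0 < c) (hm : 0 < m)
    (hα : 0 < α) (hβ : 0 < β) :
    IntegrableOn (fun a : ℝ =>
      a ^ (2 * p - 1) * Real.exp (-m * a ^ 2) * (α + a ^ 2 * β) ^ (-c)) (Ioi 0) := by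
  have h := (integrableOn_rpow_mul_exp_neg_mul_sq hm (s := 2 * p - 1) (by linarith)).mul_const
    (α ^ (-c))
  refine h.mono (by fun_prop) ?_
  filter_upwards [ae_restrict_mem measurableSet_Ioi] with a ha
  have ha : 0 < a := ha
  rw [norm_mul, norm_mul _ (α ^ (-c))]
  gcongr
  rw [Real.norm_of_nonneg (by positivity), Real.norm_of_nonneg (by positivity)]
  exact Real.rpow_le_rpow_of_nonpos hα (by nlinarith [sq_nonneg a]) (by linarith)

/-- Theorem 9: PDF of the double shadowed κ-μ Type III model, example 1,
obtained as the product of a Nakagami-m RV and a single shadowed κ-μ Type II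
(inverse Nakagami-m) RV. -/
theorem double_shadowed_typeIII_example1_pdf
    (κ μ mt ms rhat r K θ₁ : ℝ) (s₂ : ℝ → ℝ)
    (hκ : 0 < κ) (hμ : 0 < μ) (hmt : 0 < mt) (hrhat : 0 < rhat) (hms : 1 < ms)
    (hr : 0 < r) (hK : K = μ * (1 + κ)) (hθ₁ : θ₁ = (1 + ms + μ) / 2)
    (hs₂ : ∀ y : ℝ, s₂ y =
      (2 * (ms - 1) ^ ms * (1 + κ) ^ μ * μ ^ μ * y ^ (2 * μ - 1) * rhat ^ (2 * ms) /
          (betaFn ms μ *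
            (y ^ 2 * (1 + κ) * μ + rhat ^ 2 * (ms - 1 + κ * μ)) ^ (ms + μ))) *
        hyp2F1 ((ms + μ) / 2) θ₁ μ
          (4 * μ ^ 2 * κ * (1 + κ) * y ^ 2 * rhat ^ 2 /
            (y ^ 2 * (1 + κ) * μ + rhat ^ 2 * (ms - 1 + κ * μ)) ^ 2)) :
    (∫ a in Ioi (0 : ℝ),
      (1 / a) * s₂ (r / a) *
        (2 * mt ^ mt * a ^ (2 * mt - 1) * Real.exp (-mt * a ^ 2) / Real.Gamma mt)) =
    (2 * (ms - 1) ^ ms * (mt * K) ^ μ * r ^ (2 * μ - 1) /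
        (Real.Gamma mt * betaFn ms μ * rhat ^ (2 * μ) *
          (ms - 1 + κ * μ) ^ (μ + ms))) *
      ∑' i : ℕ,
        (poch ((ms + μ) / 2) i * poch θ₁ i * Real.Gamma ((i : ℝ) + ms + mt) /
            ((i.factorial : ℝ) * poch μ i * rhat ^ (2 * i))) *
          ((4 * r ^ 2 * κ * μ * K * mt) ^ (i : ℕ) / (ms - 1 + κ * μ) ^ (2 * i)) *
          tricomiU (2 * (i : ℝ) + μ + ms) (1 + (i : ℝ) + μ - mt)
            (r ^ 2 * K * mt / (rhat ^ 2 * (ms - 1 + κ * μ))) := by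
  have hA : 0 < ms - 1 + κ * μ := by have := mul_pos hκ hμ; linarith
  have hK0 : 0 < K := by rw [hK]; positivity
  have hθ : 0 < θ₁ := by rw [hθ₁]; positivity
  have hB : 0 < betaFn ms μ := by
    have := Real.Gamma_pos_of_pos (by linarith : 0 < ms)
    have := Real.Gamma_pos_of_pos hμ
    have := Real.Gamma_pos_of_pos (by linarith : 0 < ms + μ)
    unfold betaFn
    positivity
  have hm0 : 0 < ms := by linarith
  have hm1 : 0 < ms - 1 := by linarith
  have hGt := Real.Gamma_pos_of_pos hmt
  set A := ms - 1 + κ * μ with hAdef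
  set B := betaFn ms μ
  have hKμ : K ^ μ = (1 + κ) ^ μ * μ ^ μ := by
    rw [hK, mul_comm, Real.mul_rpow (by positivity) hμ.le]
  have hα : 0 < r ^ 2 * K := by positivity
  have hβ : 0 < rhat ^ 2 * A := by positivity
  let G : ℝ := 4 * (ms - 1) ^ ms * K ^ μ * r ^ (2 * μ - 1) * rhat ^ (2 * ms) * mt ^ mt /
    (B * Real.Gamma mt)
  let C : ℕ → ℝ := fun i => G * (poch ((ms + μ) / 2) i * poch θ₁ i *
    (4 * μ * κ * K * r ^ 2 * rhat ^ 2) ^ i / (poch μ i * (i.factorial : ℝ)))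
  let g : ℕ → ℝ → ℝ := fun i a => a ^ (2 * (ms + mt + i) - 1) * Real.exp (-mt * a ^ 2) *
    (r ^ 2 * K + a ^ 2 * (rhat ^ 2 * A)) ^ (-(ms + μ + 2 * (i : ℝ)))
  have hG : 0 < G := by positivity
  have hC (i : ℕ) : 0 < C i := by
    have := poch_pos (by positivity : 0 < (ms + μ) / 2) i
    have := poch_pos hθ i
    have := poch_pos hμ i
    positivity
  let w : ℝ → ℝ := fun a => 4 * μ ^ 2 * κ * (1 + κ) * (r / a) ^ 2 * rhat ^ 2 /
    ((r / a) ^ 2 * (1 + κ) * μ + rhat ^ 2 * A) ^ 2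
  let P : ℝ → ℝ := fun a => (1 / a) *
    (2 * (ms - 1) ^ ms * (1 + κ) ^ μ * μ ^ μ * (r / a) ^ (2 * μ - 1) * rhat ^ (2 * ms) /
      (B * ((r / a) ^ 2 * (1 + κ) * μ + rhat ^ 2 * A) ^ (ms + μ))) *
    (2 * mt ^ mt * a ^ (2 * mt - 1) * Real.exp (-mt * a ^ 2) / Real.Gamma mt)
  have hterm (a : ℝ) (ha : 0 < a) (i : ℕ) :
      P a * (poch ((ms + μ) / 2) i * poch θ₁ i * w a ^ i / (poch μ i * (i.factorial : ℝ))) =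
        C i * g i a := by
    have hS : 0 < r ^ 2 * K + a ^ 2 * (rhat ^ 2 * A) := by positivity
    have hD : (r / a) ^ 2 * (1 + κ) * μ + rhat ^ 2 * A =
        (r ^ 2 * K + a ^ 2 * (rhat ^ 2 * A)) / a ^ 2 := by
      rw [hK]; field_simp
    have hw : w a = 4 * μ * κ * K * r ^ 2 * rhat ^ 2 * a ^ 2 /
        (r ^ 2 * K + a ^ 2 * (rhat ^ 2 * A)) ^ 2 := by
      simp only [w]
      rw [hD]
      nth_rewrite 2 [hK]
      field_simp
    have e1 : a ^ (2 * (ms + mt + i) - 1) = a ^ (2 * ms) * a ^ (2 * mt) * (a ^ 2) ^ i / a := by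
      rw [Real.rpow_sub_one ha.ne', ← Real.rpow_add ha, ← pow_mul, ← Real.rpow_add_natCast ha.ne']
      push_cast
      ring_nf
    have e2 : (r ^ 2 * K + a ^ 2 * (rhat ^ 2 * A)) ^ (-(ms + μ + 2 * (i : ℝ))) =
        ((r ^ 2 * K + a ^ 2 * (rhat ^ 2 * A)) ^ (ms + μ) *
          ((r ^ 2 * K + a ^ 2 * (rhat ^ 2 * A)) ^ 2) ^ i)⁻¹ := by
      rw [Real.rpow_neg hS.le, ← pow_mul, ← Real.rpow_add_natCast hS.ne']
      push_cast
      rfl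
    have e3 : ((r ^ 2 * K + a ^ 2 * (rhat ^ 2 * A)) / a ^ 2) ^ (ms + μ) =
        (r ^ 2 * K + a ^ 2 * (rhat ^ 2 * A)) ^ (ms + μ) / (a ^ (2 * ms) * a ^ (2 * μ)) := by
      rw [Real.div_rpow hS.le (by positivity), ← Real.rpow_add ha, ← Real.rpow_natCast a 2,
        ← Real.rpow_mul ha.le]
      push_cast
      ring_nf
    have e4 : (r / a) ^ (2 * μ - 1) = r ^ (2 * μ - 1) * a / a ^ (2 * μ) := by
      rw [Real.div_rpow hr.le ha.le, Real.rpow_sub_one ha.ne']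
      field_simp
    have e5 : a ^ (2 * mt - 1) = a ^ (2 * mt) / a := Real.rpow_sub_one ha.ne' _
    have hp := poch_pos hμ i
    simp only [P, C, g, G]
    rw [hw, hD, e1, e2, e3, e4, e5, hKμ, div_pow, mul_pow _ (a ^ 2) i]
    have := Real.rpow_pos_of_pos hS (ms + μ)
    have := Real.rpow_pos_of_pos ha (2 * ms)
    have := Real.rpow_pos_of_pos ha (2 * μ)
    have := Real.rpow_pos_of_pos ha (2 * mt)
    field_simp
    ring
  have hw01 (a : ℝ) (ha : 0 < a) : 0 < w a ∧ w a < 1 := by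
    have hra : 0 < r / a := by positivity
    refine ⟨by positivity, ?_⟩
    simp only [w]
    rw [div_lt_one (by positivity)]
    have h1 : 0 < (r / a) ^ 2 * (1 + κ) * μ * rhat ^ 2 * (ms - 1) := by positivity
    nlinarith [sq_nonneg ((r / a) ^ 2 * (1 + κ) * μ - rhat ^ 2 * A)]
  have hgi (i : ℕ) : IntegrableOn (g i) (Ioi 0) :=
    integrableOn_sq (by positivity) (by positivity) hmt hα hβ
  calc _ = ∫ a in Ioi (0 : ℝ), ∑' i, C i * g i a := by
        refine setIntegral_congr_fun measurableSet_Ioi fun a ha => ?_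
        simp_rw [← hterm a ha, tsum_mul_left, hs₂ (r / a), hyp2F1, P, w]
        ring
    _ = ∑' i, ∫ a in Ioi (0 : ℝ), C i * g i a := by
        refine integral_tsum_of_nonneg_of_summable (fun i => (hgi i).const_mul _) (fun i => ?_) ?_
        · filter_upwards [ae_restrict_mem measurableSet_Ioi] with a ha
          have ha : 0 < a := ha
          have := hC i
          simp only [Pi.zero_apply, g]
          positivity
        · filter_upwards [ae_restrict_mem measurableSet_Ioi] with a ha
          simp_rw [← hterm a ha]
          exact (summable_hyp2F1 (by positivity) hθ hμ (hw01 a ha).1 (hw01 a ha).2).mul_left _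
    _ = _ := by
        rw [← tsum_mul_left]
        refine tsum_congr fun i => ?_
        rw [integral_const_mul, integral_sq_eq_tricomiU (by positivity) (by positivity) hmt hα hβ,
          show ms + μ + 2 * (i : ℝ) - (ms + mt + i) + 1 = 1 + (i : ℝ) + μ - mt by ring,
          show ms + μ + 2 * (i : ℝ) = 2 * i + μ + ms by ring,
          show ms + mt + (i : ℝ) = i + ms + mt by ring]
        have e1 : mt ^ (2 * (i : ℝ) + μ + ms - (i + ms + mt)) = mt ^ i * mt ^ μ / mt ^ mt := by
          rw [← Real.rpow_natCast, ← Real.rpow_add hmt, ← Real.rpow_sub hmt]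
          ring_nf
        have e2 : (rhat ^ 2 * A) ^ (-(2 * (i : ℝ) + μ + ms)) =
            (rhat ^ (2 * μ) * rhat ^ (2 * ms) * (rhat ^ (2 * i)) ^ 2 *
              (A ^ (μ + ms) * A ^ (2 * i)))⁻¹ := by
          rw [Real.rpow_neg hβ.le, Real.mul_rpow (by positivity) hA.le, ← pow_mul,
            ← Real.rpow_add hrhat, ← Real.rpow_add_natCast hrhat.ne',
            ← Real.rpow_add_natCast hA.ne', ← Real.rpow_natCast rhat 2, ← Real.rpow_mul hrhat.le]
          push_cast
          ring_nf
        have hp := poch_pos hμ i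
        simp only [C, G]
        rw [e1, e2, Real.mul_rpow hmt.le hK0.le,
          show 4 * μ * κ * K * r ^ 2 * rhat ^ 2 = 4 * r ^ 2 * κ * μ * K * rhat ^ 2 by ring,
          mul_pow _ (rhat ^ 2) i, mul_pow _ mt i, ← pow_mul]
        have := Real.rpow_pos_of_pos hmt mt
        have := Real.rpow_pos_of_pos hA (μ + ms)
        have := Real.rpow_pos_of_pos hrhat (2 * μ)
        have := Real.rpow_pos_of_pos hrhat (2 * ms)
        field_simp
        ring
end

section
/- Let κ, μ, r̂ > 0 and r > 0. For m_s > 1 let s₂(r; m_s) = 2(m_s−1)^{m_s}(1+κ)^μ μ^μ r^{2μ−1} r̂^{2m_s}/(B(m_s,μ)[r²(1+κ)μ + r̂²(m_s−1+κμ)]^{m_s+μ}) · ₂F₁((m_s+μ)/2, (1+m_s+μ)/2; μ; 4μ²κ(1+κ)r²r̂²/[r²(1+κ)μ + r̂²(m_s−1+κμ)]²) denote the single shadowed κ-μ Type II (inverse Nakagami-m) PDF. Then lim_{m_s → ∞} s₂(r; m_s) = 2μ(1+κ)^{(μ+1)/2} r^μ κ^{−(μ−1)/2} e^{−κμ} r̂^{−(μ+1)}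 e^{−μ(1+κ)r²/r̂²} I_{μ−1}(2μ√(κ(1+κ)) r/r̂), i.e., the single shadowed κ-μ Type II (inverse Nakagami-m) PDF converges pointwise to the κ-μ PDF as the scattered-component shadowing parameter tends to infinity. -/
open MeasureTheory Set

open Filter Topology

theorem tendsto_add_const_div_linear (c e : ℝ) {d : ℝ} (hd : d ≠ 0) :
    Tendsto (fun x : ℝ => (x + c) / (d * x + e)) atTop (𝓝 (1 / d)) := by
  have hc : Tendsto (fun x : ℝ => 1 + c / x) atTop (𝓝 (1 + 0)) :=
    (tendsto_const_nhds.div_atTop tendsto_id).const_add 1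
  have he : Tendsto (fun x : ℝ => d + e / x) atTop (𝓝 (d + 0)) :=
    (tendsto_const_nhds.div_atTop tendsto_id).const_add d
  have h := hc.div he (by simpa using hd)
  simp only [add_zero] at h
  refine h.congr' ?_
  filter_upwards [eventually_gt_atTop 0] with x hx
  simp only [Pi.div_apply]
  rw [← mul_div_mul_right (1 + c / x) (d + e / x) hx.ne']
  congr 1 <;> field_simp

theorem rpow_le_Gamma_add_div_Gamma_le {m s : ℝ} (hm : 1 < m) (hs : 0 < s) :
    (m - 1) ^ s ≤ Real.Gamma (m + s) / Real.Gamma m ∧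
      Real.Gamma (m + s) / Real.Gamma m ≤ (m + s) ^ s := by
  have hm0 : 0 < m - 1 := by linarith
  have hms : 0 < m + s := by linarith
  have hG : 0 < Real.Gamma m := Real.Gamma_pos_of_pos (by linarith)
  have hGs : 0 < Real.Gamma (m + s) := Real.Gamma_pos_of_pos hms
  have hpos : 0 < Real.Gamma (m + s) / Real.Gamma m := div_pos hGs hG
  have hrec : ∀ x : ℝ, 0 < x →
      Real.log (Real.Gamma (x + 1)) = Real.log x + Real.log (Real.Gamma x) := fun x hx => by
    rw [Real.Gamma_add_one hx.ne', Real.log_mul hx.ne' (Real.Gamma_pos_of_pos hx).ne']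
  have lower := Real.convexOn_log_Gamma.slope_mono_adjacent (x := m - 1) (y := m) (z := m + s)
    (mem_Ioi.2 hm0) (mem_Ioi.2 hms) (by linarith) (by linarith)
  have upper := Real.convexOn_log_Gamma.slope_mono_adjacent (x := m) (y := m + s) (z := m + s + 1)
    (mem_Ioi.2 (by linarith)) (mem_Ioi.2 (by linarith)) (by linarith) (by linarith)
  have hrec₁ := hrec (m - 1) hm0
  have hrec₂ := hrec (m + s) hms
  rw [sub_add_cancel] at hrec₁
  simp only [Function.comp_apply, add_sub_cancel_left, sub_sub_cancel, div_one] at lower upper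
  rw [le_div_iff₀ hs] at lower
  rw [div_le_iff₀ hs] at upper
  constructor
  · rw [← Real.log_le_log_iff (Real.rpow_pos_of_pos hm0 s) hpos, Real.log_rpow hm0,
      Real.log_div hGs.ne' hG.ne']
    nlinarith
  · rw [← Real.log_le_log_iff hpos (Real.rpow_pos_of_pos hms s), Real.log_rpow hms,
      Real.log_div hGs.ne' hG.ne']
    nlinarith

theorem tendsto_Gamma_add_div_Gamma_div_rpow {s d : ℝ} (hs : 0 < s) (hd : 0 < d) (e : ℝ) :
    Tendsto (fun m : ℝ => Real.Gamma (m + s) / Real.Gamma m / (d * m + e) ^ s) atTop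
      (𝓝 ((1 / d) ^ s)) := by
  have hlim : ∀ c : ℝ, Tendsto (fun m : ℝ => ((m + c) / (d * m + e)) ^ s) atTop
      (𝓝 ((1 / d) ^ s)) := fun c =>
    (tendsto_add_const_div_linear c e hd.ne').rpow_const (Or.inr hs.le)
  have hD : ∀ᶠ m : ℝ in atTop, 0 < d * m + e :=
    (tendsto_atTop_add_const_right _ e (tendsto_id.const_mul_atTop hd)).eventually_gt_atTop 0
  refine tendsto_of_tendsto_of_tendsto_of_le_of_le' (hlim (-1)) (hlim s) ?_ ?_
  · filter_upwards [hD, eventually_gt_atTop 1] with m hDm hm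
    rw [Real.div_rpow (by linarith) hDm.le]
    have := (rpow_le_Gamma_add_div_Gamma_le hm hs).1
    rw [← sub_eq_add_neg]
    gcongr
  · filter_upwards [hD, eventually_gt_atTop 1] with m hDm hm
    rw [Real.div_rpow (by linarith) hDm.le]
    have := (rpow_le_Gamma_add_div_Gamma_le hm hs).2
    gcongr

theorem poch_eq_prod {a : ℝ} (ha : 0 < a) (n : ℕ) :
    poch a n = ∏ j ∈ Finset.range n, (a + j) := by
  induction n with
  | zero => simp [poch, (Real.Gamma_pos_of_pos ha).ne']
  | succ n ih =>
    have han : (0 : ℝ) < a + n := by positivity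
    rw [Finset.prod_range_succ, ← ih, poch, poch, Nat.cast_succ, ← add_assoc,
      Real.Gamma_add_one han.ne']
    ring

theorem factorial_eq_prod_cast (n : ℕ) :
    (n.factorial : ℝ) = ∏ j ∈ Finset.range n, ((j : ℝ) + 1) := by
  rw [← Finset.prod_range_add_one_eq_factorial]
  push_cast
  rfl

theorem hyp2F1_term_eq_prod {a b c : ℝ} (ha : 0 < a) (hb : 0 < b) (hc : 0 < c) (z : ℝ) (n : ℕ) :
    poch a n * poch b n * z ^ n / (poch c n * (n.factorial : ℝ)) =
      ∏ j ∈ Finset.range n, ((a + j) * (b + j) * z / ((c + j) * (j + 1))) := by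
  rw [poch_eq_prod ha, poch_eq_prod hb, poch_eq_prod hc, factorial_eq_prod_cast]
  simp only [Finset.prod_div_distrib, Finset.prod_mul_distrib, Finset.prod_const,
    Finset.card_range]

theorem summable_prod_range_of_tendsto {F : ℕ → ℝ} {l : ℝ} (hF : ∀ j, 0 < F j)
    (hl : l < 1) (h : Tendsto F atTop (𝓝 l)) :
    Summable fun n => ∏ j ∈ Finset.range n, F j := by
  have hpos : ∀ n, 0 < ∏ j ∈ Finset.range n, F j := fun n => Finset.prod_pos fun j _ => hF j
  refine summable_of_ratio_test_tendsto_lt_one hl (.of_forall fun n => (hpos n).ne') ?_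
  refine h.congr fun n => ?_
  rw [Real.norm_of_nonneg (hpos _).le, Real.norm_of_nonneg (hpos _).le, Finset.prod_range_succ,
    mul_div_cancel_left₀ _ (hpos n).ne']

/-- Confluence of `₂F₁` to `₀F₁`. -/
theorem tendsto_hyp2F1_half {s d C : ℝ} (hs : 0 < s) (hd : 0 < d) (hC : 0 < C) (e : ℝ) :
    Tendsto (fun m : ℝ => hyp2F1 ((m + s) / 2) ((1 + m + s) / 2) s (C / (d * m + e) ^ 2)) atTop
      (𝓝 (∑' n : ℕ, (C / (4 * d ^ 2)) ^ n / (poch s n * (n.factorial : ℝ)))) := by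
  set P := C / d ^ 2 with hP
  have hPpos : 0 < P := by positivity
  set N := 2 * P + 2 with hN
  have hNpos : 0 < N := by positivity
  set F : ℕ → ℝ := fun j =>
    P * (1 + (s + 1 + 2 * j) / N) ^ 2 / ((s + j) * (j + 1)) with hF
  have hFpos : ∀ j, 0 < F j := fun j => by positivity
  have hFlim : Tendsto F atTop (𝓝 (4 * P / N ^ 2)) := by
    have h₁ := (tendsto_add_const_div_linear ((N + s + 1) / 2) s one_ne_zero).comp
      (tendsto_natCast_atTop_atTop (R := ℝ))
    have h₂ := (tendsto_add_const_div_linear ((N + s + 1) / 2) 1 one_ne_zero).comp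
      (tendsto_natCast_atTop_atTop (R := ℝ))
    have h := (h₁.mul h₂).const_mul (4 * P / N ^ 2)
    simp only [div_one, mul_one] at h
    refine h.congr fun j => ?_
    have hj : (j : ℝ) + s ≠ 0 := by positivity
    have hj' : s + (j : ℝ) ≠ 0 := by positivity
    simp only [Function.comp_apply, one_mul, hF]
    field_simp
    ring
  have hsum : Summable fun n => ∏ j ∈ Finset.range n, F j := by
    refine summable_prod_range_of_tendsto hFpos ?_ hFlim
    rw [div_lt_one (by positivity)]
    nlinarith
  have hD : ∀ᶠ m : ℝ in atTop, 0 < d / 2 * m + e :=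
    (tendsto_atTop_add_const_right _ e
      (tendsto_id.const_mul_atTop (half_pos hd))).eventually_gt_atTop 0
  refine tendsto_tsum_of_dominated_convergence hsum (fun n => ?_) ?_
  · have hterm : (C / (4 * d ^ 2)) ^ n / (poch s n * (n.factorial : ℝ)) =
        ∏ j ∈ Finset.range n, (C / (4 * d ^ 2) / ((s + j) * (j + 1))) := by
      rw [poch_eq_prod hs, factorial_eq_prod_cast]
      simp only [Finset.prod_div_distrib, Finset.prod_mul_distrib, Finset.prod_const,
        Finset.card_range, div_pow, mul_pow]
    rw [hterm]
    have hprod : Tendsto (fun m : ℝ => ∏ j ∈ Finset.range n,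
        (((m + s) / 2 + j) * ((1 + m + s) / 2 + j) * (C / (d * m + e) ^ 2) /
          ((s + j) * (j + 1)))) atTop
        (𝓝 (∏ j ∈ Finset.range n, (C / (4 * d ^ 2) / ((s + j) * (j + 1))))) := by
      refine tendsto_finsetProd _ fun j _ => Tendsto.div_const ?_ _
      have h := ((tendsto_add_const_div_linear (s + 2 * j) e hd.ne').mul
        (tendsto_add_const_div_linear (1 + s + 2 * j) e hd.ne')).const_mul (C / 4)
      convert h using 2
      · rw [div_mul_div_comm]
        ring
      · field_simp
    refine hprod.congr' ?_
    filter_upwards [eventually_gt_atTop 0] with m hm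
    rw [hyp2F1_term_eq_prod (by positivity) (by positivity) hs]
  · filter_upwards [hD, eventually_ge_atTop N] with m hDm hm n
    have hm0 : 0 < m := hNpos.trans_le hm
    rw [hyp2F1_term_eq_prod (by positivity) (by positivity) hs, Real.norm_of_nonneg
      (Finset.prod_nonneg fun j _ => by positivity)]
    refine Finset.prod_le_prod (fun j _ => by positivity) fun j _ => ?_
    have hDle : d / 2 * m ≤ d * m + e := by linarith
    have hz : C / (d * m + e) ^ 2 ≤ C / (d / 2 * m) ^ 2 := by gcongr
    have hc : 1 + (s + 1 + 2 * j) / m ≤ 1 + (s + 1 + 2 * j) / N := by gcongr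
    have hA : ((m + s) / 2 + j) * ((1 + m + s) / 2 + j) ≤ ((1 + m + s) / 2 + j) ^ 2 := by
      rw [pow_two]
      gcongr
      linarith
    have hnum : ((m + s) / 2 + j) * ((1 + m + s) / 2 + j) * (C / (d * m + e) ^ 2) ≤
        P * (1 + (s + 1 + 2 * j) / N) ^ 2 :=
      calc _ ≤ ((1 + m + s) / 2 + j) ^ 2 * (C / (d / 2 * m) ^ 2) := by gcongr
        _ = P * (1 + (s + 1 + 2 * j) / m) ^ 2 := by
          rw [hP]
          field_simp
          ring
        _ ≤ _ := by gcongr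
    simp only [hF]
    gcongr

theorem tendsto_linear_div_linear_rpow_self {d : ℝ} (hd : 0 < d) (c e : ℝ) :
    Tendsto (fun m : ℝ => ((d * m + c) / (d * m + e)) ^ m) atTop
      (𝓝 (Real.exp ((c - e) / d))) := by
  have hD : ∀ᶠ m : ℝ in atTop, 0 < d * m + e :=
    (tendsto_atTop_add_const_right _ e (tendsto_id.const_mul_atTop hd)).eventually_gt_atTop 0
  have hg : Tendsto (fun m : ℝ => m * ((c - e) / (d * m + e))) atTop (𝓝 ((c - e) / d)) := by
    have h := (tendsto_add_const_div_linear 0 e hd.ne').const_mul (c - e)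
    convert h using 2 <;> ring
  refine (Real.tendsto_one_add_rpow_exp_of_tendsto hg).congr' ?_
  filter_upwards [hD] with m hm
  congr 1
  field_simp
  ring

theorem besselI_sub_one_eq {s x : ℝ} (hs : 0 < s) (hx : 0 < x) :
    besselI (s - 1) x = (x / 2) ^ (s - 1) / Real.Gamma s *
      ∑' n : ℕ, ((x / 2) ^ 2) ^ n / (poch s n * (n.factorial : ℝ)) := by
  rw [besselI, ← tsum_mul_left]
  refine tsum_congr fun n => ?_
  have hG : Real.Gamma s ≠ 0 := (Real.Gamma_pos_of_pos hs).ne'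
  have hGn : Real.Gamma (s + n) ≠ 0 := (Real.Gamma_pos_of_pos (by positivity)).ne'
  have hpow : (x / 2) ^ (2 * (n : ℝ)) = ((x / 2) ^ 2) ^ n := by
    rw [← pow_mul, ← Real.rpow_natCast, Nat.cast_mul, Nat.cast_ofNat]
  rw [Real.rpow_add (by positivity), hpow, poch, show s - 1 + n + 1 = s + n by ring]
  field_simp

/-- Table IV: the single shadowed κ-μ Type II (inverse Nakagami-m) PDF
converges pointwise to the κ-μ PDF as the scattered-component shadowing
parameter m_s → ∞. -/
theorem single_shadowed_typeII_limit_kappa_mu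
    (κ μ rhat r : ℝ)
    (hκ : 0 < κ) (hμ : 0 < μ) (hrhat : 0 < rhat) (hr : 0 < r) :
    Filter.Tendsto
      (fun ms : ℝ =>
        (2 * (ms - 1) ^ ms * (1 + κ) ^ μ * μ ^ μ * r ^ (2 * μ - 1) *
            rhat ^ (2 * ms) /
            (betaFn ms μ *
              (r ^ 2 * (1 + κ) * μ + rhat ^ 2 * (ms - 1 + κ * μ)) ^ (ms + μ))) *
          hyp2F1 ((ms + μ) / 2) ((1 + ms + μ) / 2) μ
            (4 * μ ^ 2 * κ * (1 + κ) * r ^ 2 * rhat ^ 2 /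
              (r ^ 2 * (1 + κ) * μ + rhat ^ 2 * (ms - 1 + κ * μ)) ^ 2))
      Filter.atTop
      (nhds (2 * μ * (1 + κ) ^ ((μ + 1) / 2) * r ^ μ * κ ^ (-(μ - 1) / 2) *
        Real.exp (-(κ * μ)) * rhat ^ (-(μ + 1)) *
        Real.exp (-μ * (1 + κ) * r ^ 2 / rhat ^ 2) *
        besselI (μ - 1) (2 * μ * Real.sqrt (κ * (1 + κ)) * r / rhat))) := by
  set d := rhat ^ 2 with hd
  have hdpos : 0 < d := by positivity
  set e := r ^ 2 * (1 + κ) * μ + d * (κ * μ - 1) with he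
  have hκ1 : 0 < 1 + κ := by linarith
  set C := 4 * μ ^ 2 * κ * (1 + κ) * r ^ 2 * d with hC
  set X := 2 * μ * Real.sqrt (κ * (1 + κ)) * r / rhat with hX
  have hXpos : 0 < X := by positivity
  have hXsq : (X / 2) ^ 2 = C / (4 * d ^ 2) := by
    have hsq : Real.sqrt (κ * (1 + κ)) ^ 2 = κ * (1 + κ) := Real.sq_sqrt (by positivity)
    calc (X / 2) ^ 2 = μ ^ 2 * Real.sqrt (κ * (1 + κ)) ^ 2 * r ^ 2 / rhat ^ 2 := by
          rw [hX]; ring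
      _ = _ := by
          rw [hsq, hC, hd]
          field_simp
  have hlim := (((tendsto_linear_div_linear_rpow_self hdpos (-d) e).mul
    (tendsto_Gamma_add_div_Gamma_div_rpow hμ hdpos e)).const_mul
      (2 * (1 + κ) ^ μ * μ ^ μ * r ^ (2 * μ - 1) / Real.Gamma μ)).mul
    (tendsto_hyp2F1_half hμ hdpos (C := C) (by positivity) e)
  have hD : ∀ᶠ m : ℝ in atTop, 0 < d * m + e :=
    (tendsto_atTop_add_const_right _ e (tendsto_id.const_mul_atTop hdpos)).eventually_gt_atTop 0
  have hG : Real.Gamma μ ≠ 0 := (Real.Gamma_pos_of_pos hμ).ne'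
  rw [besselI_sub_one_eq hμ hXpos, hXsq]
  convert hlim.congr' ?_ using 2
  · rw [← mul_assoc]
    congr 1
    have hexp : Real.exp ((-d - e) / d) =
        Real.exp (-(κ * μ)) * Real.exp (-μ * (1 + κ) * r ^ 2 / d) := by
      rw [← Real.exp_add]
      congr 1
      rw [he]
      field_simp
      ring
    have hpow : μ * (1 + κ) ^ ((μ + 1) / 2) * r ^ μ * κ ^ (-(μ - 1) / 2) * rhat ^ (-(μ + 1)) *
        (X / 2) ^ (μ - 1) =
        (1 + κ) ^ μ * μ ^ μ * r ^ (2 * μ - 1) * (1 / d) ^ μ := by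
      have hlogX : Real.log (X / 2) = Real.log μ + (Real.log κ + Real.log (1 + κ)) / 2 +
          Real.log r - Real.log rhat := by
        rw [show X / 2 = μ * Real.sqrt (κ * (1 + κ)) * r / rhat by rw [hX]; ring,
          Real.log_div (by positivity) (by positivity), Real.log_mul (by positivity) hr.ne',
          Real.log_mul hμ.ne' (by positivity), Real.log_sqrt (by positivity),
          Real.log_mul hκ.ne' hκ1.ne']
      have hlogd : Real.log (1 / d) = -(2 * Real.log rhat) := by
        rw [one_div, Real.log_inv, hd, Real.log_pow]
        norm_num
      nth_rewrite 1 [← Real.exp_log hμ]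
      rw [Real.rpow_def_of_pos hκ1, Real.rpow_def_of_pos hr, Real.rpow_def_of_pos hκ,
        Real.rpow_def_of_pos hrhat, Real.rpow_def_of_pos (by positivity : 0 < X / 2),
        Real.rpow_def_of_pos hκ1, Real.rpow_def_of_pos hμ, Real.rpow_def_of_pos hr,
        Real.rpow_def_of_pos (by positivity : 0 < 1 / d), hlogX, hlogd]
      simp only [← Real.exp_add]
      congr 1
      ring
    rw [hexp]
    linear_combination (2 * Real.exp (-(κ * μ)) * Real.exp (-μ * (1 + κ) * r ^ 2 / d) /
      Real.Gamma μ) * hpow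
  · filter_upwards [hD, eventually_gt_atTop 1] with m hDm hm
    have hGm : Real.Gamma m ≠ 0 := (Real.Gamma_pos_of_pos (by linarith)).ne'
    have hGms : Real.Gamma (m + μ) ≠ 0 := (Real.Gamma_pos_of_pos (by linarith)).ne'
    have hden : r ^ 2 * (1 + κ) * μ + d * (m - 1 + κ * μ) = d * m + e := by
      rw [he]
      ring
    have hrpow : rhat ^ (2 * m) = d ^ m := by
      rw [hd, ← Real.rpow_natCast, ← Real.rpow_mul hrhat.le, Nat.cast_ofNat]
    rw [hden, hrpow, Real.rpow_add hDm, show d * m + -d = d * (m - 1) by ring,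
      Real.div_rpow (mul_nonneg hdpos.le (by linarith)) hDm.le,
      Real.mul_rpow hdpos.le (by linarith), betaFn]
    congr 1
    have h₁ : (d * m + e) ^ m ≠ 0 := (Real.rpow_pos_of_pos hDm _).ne'
    have h₂ : (d * m + e) ^ μ ≠ 0 := (Real.rpow_pos_of_pos hDm _).ne'
    field_simp
end
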